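/- For all integers m ≥ 1, n ≥ 1 and 0 ≤ d ≤ ⌊(n−1)/2⌋, the number of admissible pinnacle sets of cardinality at most d in Z_m ≀ S_n is given by the alternating sum: #APS_d(m,n) = Σ_{i=0}^{d} C(n,i) · m^i · (−1)^{i+d} (an identity of integers). -/

import Mathlib

open Finset

/-- `Prec p q` means the colored symbol `p = ξ^{p.1}(p.2)` precedes (is smaller than)
`q = ξ^{q.1}(q.2)`: `a > b`, or (`a = b` and `x > y`). -/
def Prec (p q : ℕ × ℕ) : Prop :=
  q.1 < p.1 ∨ (p.1 = q.1 ∧ q.2 < p.2)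

instance : DecidableRel Prec := fun p q => by
  unfold Prec; infer_instance

/-- `w : ℕ → ℕ × ℕ` (read on positions `1,…,n`) is an element of `Z_m ≀ S_n`:
each entry has color `< m` and norm in `{1,…,n}`, and the norms are pairwise distinct. -/
def IsGenPerm (m n : ℕ) (w : ℕ → ℕ × ℕ) : Prop :=
  (∀ i ∈ Finset.Icc 1 n, (w i).1 < m ∧ (w i).2 ∈ Finset.Icc 1 n) ∧
    Set.InjOn (fun i => (w i).2) (Set.Icc 1 n)

/-- The pinnacle set of the word `w`: values at interior positions `2 ≤ i ≤ n-1`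
that strictly dominate both neighbors. -/
def pin (n : ℕ) (w : ℕ → ℕ × ℕ) : Finset (ℕ × ℕ) :=
  ((Finset.Icc 2 (n - 1)).filter
      (fun i => Prec (w (i - 1)) (w i) ∧ Prec (w (i + 1)) (w i))).image w

/-- `P` is an admissible pinnacle set for `Z_m ≀ S_n`. -/
def IsAdmissible (m n : ℕ) (P : Finset (ℕ × ℕ)) : Prop :=
  ∃ w, IsGenPerm m n w ∧ pin n w = P

/-- `APS m n d` : admissible pinnacle sets for `Z_m ≀ S_n` of cardinality at most `d`. -/
def APS (m n d : ℕ) : Set (Finset (ℕ × ℕ)) :=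
  {P | IsAdmissible m n P ∧ P.card ≤ d}

theorem Prec.asymm {p q : ℕ × ℕ} (h : Prec p q) : ¬ Prec q p := by
  unfold Prec at *; omega

theorem Prec.trans {p q r : ℕ × ℕ} (h : Prec p q) (h' : Prec q r) : Prec p r := by
  unfold Prec at *; omega

theorem Prec.ne {p q : ℕ × ℕ} (h : Prec p q) : p ≠ q := by
  rintro rfl; exact h.asymm h

theorem Prec.trichotomous (p q : ℕ × ℕ) : Prec p q ∨ p = q ∨ Prec q p := by
  rw [Prod.ext_iff]; unfold Prec; omega

/-- A nonempty finite set of symbols has a largest element for `Prec`. -/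
theorem exists_prec_max (S : Finset (ℕ × ℕ)) (hS : S.Nonempty) :
    ∃ p ∈ S, ∀ q ∈ S, q ≠ p → Prec q p := by
  induction hS using Finset.Nonempty.cons_induction with
  | singleton a => exact ⟨a, by simp, by simp⟩
  | cons a s ha hs ih =>
    obtain ⟨p, hp, hmax⟩ := ih
    rcases Prec.trichotomous p a with h | h | h
    · refine ⟨a, by simp, fun q hq hqa => ?_⟩
      rcases Finset.mem_cons.1 hq with rfl | hq
      · exact absurd rfl hqa
      · by_cases hqp : q = p
        · exact hqp ▸ h
        · exact (hmax q hq hqp).trans h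
    · exact absurd (h ▸ hp) ha
    · refine ⟨p, by simp [hp], fun q hq hqp => ?_⟩
      rcases Finset.mem_cons.1 hq with rfl | hq
      · exact h
      · exact hmax q hq hqp

/-- A finite set of symbols can be listed increasingly for `Prec`. -/
theorem exists_prec_enumeration (k : ℕ) (S : Finset (ℕ × ℕ)) (hk : S.card = k) :
    ∃ f : ℕ → ℕ × ℕ, (Finset.range k).image f = S ∧ ∀ i j, i < j → j < k → Prec (f i) (f j) := by
  induction k generalizing S with
  | zero => exact ⟨fun _ => (0, 0), by simp [Finset.card_eq_zero.1 hk], by omega⟩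
  | succ k ih =>
    obtain ⟨p, hp, hmax⟩ := exists_prec_max S (Finset.card_pos.1 (by omega))
    obtain ⟨f, hf, hinc⟩ := ih (S.erase p) (by rw [Finset.card_erase_of_mem hp]; omega)
    have hmem : ∀ i < k, f i ∈ S.erase p := fun i hi =>
      hf ▸ Finset.mem_image_of_mem f (Finset.mem_range.2 hi)
    refine ⟨fun i => if i < k then f i else p, ?_, ?_⟩
    · rw [Finset.range_add_one, Finset.image_insert]
      have : (Finset.range k).image (fun i => if i < k then f i else p) = S.erase p := by
        rw [← hf]
        exact Finset.image_congr fun i hi => by simp_all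
      rw [this]
      simp [Finset.insert_erase hp]
    · intro i j hij hj
      have hi : i < k := by omega
      by_cases hjk : j < k
      · simpa [hi, hjk] using hinc i j hij hjk
      · have := Finset.mem_erase.1 (hmem i hi)
        simpa [hi, hjk] using hmax _ this.2 this.1

/-- The sets of colored symbols of norm at most `r`, with pairwise distinct norms and colors at
most `M`, such that for each element of the extreme color `M` the norms beyond it not used by `P`,
together with `h` extra ones, outnumber the elements of color `M` up to and including it. -/
def IsBallot (M r h : ℕ) (P : Finset (ℕ × ℕ)) : Prop :=
  (∀ p ∈ P, p.1 ≤ M ∧ 1 ≤ p.2 ∧ p.2 ≤ r) ∧ Set.InjOn Prod.snd (P : Set (ℕ × ℕ)) ∧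
    ∀ p ∈ P, p.1 = M →
      (P.filter fun q => q.1 = M ∧ p.2 ≤ q.2).card + 1 ≤
        ((Finset.Icc 1 r).filter fun y => p.2 < y ∧ y ∉ P.image Prod.snd).card + h

theorem isBallot_of_isAdmissible {M n : ℕ} {P : Finset (ℕ × ℕ)}
    (hP : IsAdmissible (M + 1) n P) : IsBallot M n 0 P := by
  obtain ⟨w, ⟨hw, hinj⟩, rfl⟩ := hP
  set I := (Finset.Icc 2 (n - 1)).filter
      (fun i => Prec (w (i - 1)) (w i) ∧ Prec (w (i + 1)) (w i)) with hI
  have hpin : pin n w = I.image w := rfl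
  have hImem : ∀ i ∈ I, 2 ≤ i ∧ i ≤ n - 1 ∧ Prec (w (i - 1)) (w i) ∧ Prec (w (i + 1)) (w i) := by
    intro i hi
    simpa [hI, and_assoc] using hi
  rw [hpin]
  refine ⟨?_, ?_, ?_⟩
  · intro p hp
    obtain ⟨i, hi, rfl⟩ := Finset.mem_image.1 hp
    have h := hImem i hi
    have h2 := hw i (Finset.mem_Icc.2 (by omega))
    rw [Finset.mem_Icc] at h2
    omega
  · intro p hp q hq hpq
    obtain ⟨i, hi, rfl⟩ := Finset.mem_image.1 hp
    obtain ⟨j, hj, rfl⟩ := Finset.mem_image.1 hq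
    have h := hImem i hi
    have h' := hImem j hj
    rw [hinj (Set.mem_Icc.2 (by omega)) (Set.mem_Icc.2 (by omega)) hpq]
  · intro p hp hpM
    set K := I.filter fun i => (w i).1 = M ∧ p.2 ≤ (w i).2 with hK
    have hKne : K.Nonempty := by
      obtain ⟨i, hi, rfl⟩ := Finset.mem_image.1 hp
      exact ⟨i, by simp [hK, hi, hpM]⟩
    have hcardK : ((I.image w).filter fun q => q.1 = M ∧ p.2 ≤ q.2).card ≤ K.card := by
      rw [Finset.filter_image]
      exact Finset.card_image_le
    have hKI : ∀ i ∈ K, i ∈ I ∧ (w i).1 = M ∧ p.2 ≤ (w i).2 := fun i hi => by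
      simpa [hK] using hi
    set J := insert (K.max' hKne + 1) (K.image fun i => i - 1) with hJ
    have hcardJ : J.card = K.card + 1 := by
      rw [hJ, Finset.card_insert_of_notMem, Finset.card_image_of_injOn]
      · intro i hi j hj hij
        have h1 := (hImem i (hKI i hi).1).1
        have h2 := (hImem j (hKI j hj).1).1
        simp only at hij
        omega
      · intro hmem
        obtain ⟨i, hi, hi'⟩ := Finset.mem_image.1 hmem
        have := K.le_max' i hi
        omega
    have hJmem : ∀ j ∈ J, ∃ i ∈ K, j = i - 1 ∨ j = i + 1 := by
      intro j hj
      rcases Finset.mem_insert.1 hj with rfl | hj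
      · exact ⟨_, K.max'_mem hKne, Or.inr rfl⟩
      · obtain ⟨i, hi, rfl⟩ := Finset.mem_image.1 hj
        exact ⟨i, hi, Or.inl rfl⟩
    have hJn : ∀ j ∈ J, 1 ≤ j ∧ j ≤ n := by
      intro j hj
      obtain ⟨i, hi, hji⟩ := hJmem j hj
      have := hImem i (hKI i hi).1
      omega
    have hle : J.card ≤
        ((Finset.Icc 1 n).filter fun y => p.2 < y ∧ y ∉ (I.image w).image Prod.snd).card := by
      refine Finset.card_le_card_of_injOn (fun j => (w j).2) ?_
        (hinj.mono fun j hj => Set.mem_Icc.2 (hJn j hj))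
      intro j hj
      have hjn := hJn j hj
      have hwj := hw j (Finset.mem_Icc.2 hjn)
      obtain ⟨i, hi, hji⟩ := hJmem j hj
      have hiI := hImem i (hKI i hi).1
      have hprec : Prec (w j) (w i) := by
        rcases hji with rfl | rfl
        · exact hiI.2.2.1
        · exact hiI.2.2.2
      have hiK := (hKI i hi).2
      simp only [Finset.coe_filter, Set.mem_ofPred_eq]
      refine ⟨hwj.2, ?_, ?_⟩
      · unfold Prec at hprec; omega
      · intro hmem
        obtain ⟨q, hq, hqj⟩ := Finset.mem_image.1 hmem
        obtain ⟨i', hi', rfl⟩ := Finset.mem_image.1 hq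
        have hi'I := hImem i' hi'
        have : i' = j := hinj (Set.mem_Icc.2 (by omega)) (Set.mem_Icc.2 (by omega)) hqj
        subst this
        refine hprec.asymm ?_
        rcases hji with rfl | rfl
        · have := hi'I.2.2.2
          rwa [Nat.sub_add_cancel (by omega)] at this
        · exact hi'I.2.2.1
    omega

theorem isAdmissible_of_isBallot {M n : ℕ} {P : Finset (ℕ × ℕ)} (hP : IsBallot M n 0 P)
    (hcard : 2 * P.card + 1 ≤ n) : IsAdmissible (M + 1) n P := by
  obtain ⟨hmem, hinj, hcount⟩ := hP
  obtain ⟨d, hd⟩ : ∃ d, P.card = d := ⟨_, rfl⟩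
  rw [hd] at hcard
  set N := (Finset.Icc 1 n) \ P.image Prod.snd with hN
  have hNcard : N.card = n - d := by
    rw [hN, Finset.card_sdiff_of_subset, Finset.card_image_of_injOn hinj, hd]
    · simp
    · intro y hy
      obtain ⟨p, hp, rfl⟩ := Finset.mem_image.1 hy
      exact Finset.mem_Icc.2 (hmem p hp).2
  obtain ⟨p, hpP, hp⟩ := exists_prec_enumeration d P hd
  obtain ⟨v, hvN, hv⟩ := exists_prec_enumeration (n - d) (N.image fun y => (M, y)) (by
    rw [Finset.card_image_of_injective _ (Prod.mk_right_injective M), hNcard])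
  have hpmem : ∀ i < d, p i ∈ P := fun i hi =>
    hpP ▸ Finset.mem_image_of_mem p (Finset.mem_range.2 hi)
  have hvmem : ∀ i < n - d, (v i).1 = M ∧ (v i).2 ∈ N := fun i hi => by
    have : v i ∈ N.image fun y => (M, y) :=
      hvN ▸ Finset.mem_image_of_mem v (Finset.mem_range.2 hi)
    obtain ⟨y, hy, hyv⟩ := Finset.mem_image.1 this
    rw [← hyv]
    exact ⟨rfl, hy⟩
  have hright : ∀ i < d, Prec (v (i + 1)) (p i) := by
    intro i hi
    have hcol := (hmem _ (hpmem i hi)).1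
    have hvi := hvmem (i + 1) (by omega)
    rcases hcol.lt_or_eq with hlt | heq
    · left; omega
    by_contra hnot
    have hc := hcount _ (hpmem i hi) heq
    have h1 : i + 1 ≤ (P.filter fun q => q.1 = M ∧ (p i).2 ≤ q.2).card := by
      have hpinj : Set.InjOn p (Finset.range (i + 1) : Set ℕ) := by
        intro a ha b hb hab
        simp only [Finset.coe_range, Set.mem_Iio] at ha hb
        rcases lt_trichotomy a b with h | h | h
        · exact absurd hab (hp a b h (by omega)).ne
        · exact h
        · exact absurd hab.symm (hp b a h (by omega)).ne
      rw [← Finset.card_range (i + 1), ← Finset.card_image_of_injOn hpinj]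
      refine Finset.card_le_card fun q hq => ?_
      obtain ⟨a, ha, rfl⟩ := Finset.mem_image.1 hq
      rw [Finset.mem_range] at ha
      have hac := (hmem _ (hpmem a (by omega))).1
      refine Finset.mem_filter.2 ⟨hpmem a (by omega), ?_⟩
      rcases (Nat.lt_succ_iff.1 ha).lt_or_eq with h | rfl
      · have := hp a i h hi
        unfold Prec at this; omega
      · exact ⟨heq, le_rfl⟩
    have h2 : ((Finset.Icc 1 n).filter fun y => (p i).2 < y ∧ y ∉ P.image Prod.snd).card ≤
        i + 1 := by
      rw [← Finset.card_range (i + 1)]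
      refine (Finset.card_le_card (t := (Finset.range (i + 1)).image fun a => (v a).2) ?_).trans
        Finset.card_image_le
      intro y hy
      obtain ⟨hy1, hy2, hy3⟩ := Finset.mem_filter.1 hy
      have : (M, y) ∈ (Finset.range (n - d)).image v := by
        rw [hvN]
        exact Finset.mem_image_of_mem _ (Finset.mem_sdiff.2 ⟨hy1, hy3⟩)
      obtain ⟨a, ha, hay⟩ := Finset.mem_image.1 this
      rw [Finset.mem_range] at ha
      refine Finset.mem_image.2 ⟨a, Finset.mem_range.2 ?_, by rw [hay]⟩
      by_contra hai
      have hprec : Prec (v a) (p i) := by rw [hay]; right; exact ⟨heq.symm, hy2⟩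
      rcases (not_lt.1 hai).lt_or_eq with h | h
      · exact hnot ((hv _ _ h ha).trans hprec)
      · exact hnot (h ▸ hprec)
    omega
  have hleft : ∀ i < d, Prec (v i) (p i) := fun i hi =>
    (hv i (i + 1) (by omega) (by omega)).trans (hright i hi)
  set w : ℕ → ℕ × ℕ := fun k =>
    if k ≤ 2 * d + 1 then (if k % 2 = 1 then v (k / 2) else p (k / 2 - 1)) else v (k - 1 - d)
    with hw
  have hwodd : ∀ i ≤ d, w (2 * i + 1) = v i := fun i hi => by
    rw [hw]; simp only
    rw [if_pos (by omega), if_pos (by omega)]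
    congr 1; omega
  have hweven : ∀ i < d, w (2 * i + 2) = p i := fun i hi => by
    rw [hw]; simp only
    rw [if_pos (by omega), if_neg (by omega)]
    congr 1; omega
  have hwtail : ∀ i, d < i → w (i + 1 + d) = v i := fun i hi => by
    rw [hw]; simp only
    rw [if_neg (by omega)]
    congr 1; omega
  have hcases : ∀ k, 1 ≤ k → k ≤ n → (∃ i ≤ d, k = 2 * i + 1) ∨ (∃ i < d, k = 2 * i + 2) ∨
      (∃ i, d < i ∧ i < n - d ∧ k = i + 1 + d) := by
    intro k hk hkn
    by_cases h : k ≤ 2 * d + 1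
    · rcases Nat.even_or_odd' k with ⟨c, rfl | rfl⟩
      · exact Or.inr (Or.inl ⟨c - 1, by omega, by omega⟩)
      · exact Or.inl ⟨c, by omega, rfl⟩
    · exact Or.inr (Or.inr ⟨k - 1 - d, by omega, by omega, by omega⟩)
  have hcases' : ∀ k, 1 ≤ k → k ≤ n → (∃ i < n - d, w k = v i ∧
      ((i ≤ d ∧ k = 2 * i + 1) ∨ (d < i ∧ k = i + 1 + d))) ∨
      (∃ i < d, w k = p i ∧ k = 2 * i + 2) := by
    intro k hk hkn
    rcases hcases k hk hkn with ⟨i, hi, rfl⟩ | ⟨i, hi, rfl⟩ | ⟨i, hi, hin, rfl⟩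
    · exact Or.inl ⟨i, by omega, hwodd i hi, Or.inl ⟨hi, rfl⟩⟩
    · exact Or.inr ⟨i, hi, hweven i hi, rfl⟩
    · exact Or.inl ⟨i, hin, hwtail i hi, Or.inr ⟨hi, rfl⟩⟩
  have hpv : ∀ i j, i < d → j < n - d → (p i).2 ≠ (v j).2 := by
    intro i j hi hj h
    have := (Finset.mem_sdiff.1 (hvmem j hj).2).2
    exact this (h ▸ Finset.mem_image_of_mem _ (hpmem i hi))
  have hvinj : ∀ i j, i < n - d → j < n - d → (v i).2 = (v j).2 → i = j := by
    intro i j hi hj h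
    have heq : v i = v j := Prod.ext ((hvmem i hi).1.trans (hvmem j hj).1.symm) h
    rcases lt_trichotomy i j with h | h | h
    · exact absurd heq (hv i j h hj).ne
    · exact h
    · exact absurd heq.symm (hv j i h hi).ne
  have hpinj : ∀ i j, i < d → j < d → (p i).2 = (p j).2 → i = j := by
    intro i j hi hj h
    have heq : p i = p j := hinj (hpmem i hi) (hpmem j hj) h
    rcases lt_trichotomy i j with h | h | h
    · exact absurd heq (hp i j h hj).ne
    · exact h
    · exact absurd heq.symm (hp j i h hi).ne
  refine ⟨w, ⟨?_, ?_⟩, ?_⟩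
  · intro k hk
    rw [Finset.mem_Icc] at hk
    rcases hcases' k hk.1 hk.2 with ⟨i, hi, hwk, -⟩ | ⟨i, hi, hwk, -⟩
    · rw [hwk, (hvmem i hi).1]
      exact ⟨by omega, (Finset.mem_sdiff.1 (hvmem i hi).2).1⟩
    · rw [hwk]
      have := hmem _ (hpmem i hi)
      exact ⟨by omega, Finset.mem_Icc.2 this.2⟩
  · intro k hk l hl hkl
    simp only at hkl
    rcases hcases' k hk.1 hk.2 with ⟨i, hi, hwk, hik⟩ | ⟨i, hi, hwk, hik⟩ <;>
      rcases hcases' l hl.1 hl.2 with ⟨j, hj, hwl, hjl⟩ | ⟨j, hj, hwl, hjl⟩ <;>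
      rw [hwk, hwl] at hkl
    · have := hvinj i j hi hj hkl
      omega
    · exact absurd hkl.symm (hpv j i hj hi)
    · exact absurd hkl (hpv i j hi hj)
    · have := hpinj i j hi hj hkl
      omega
  · unfold pin
    ext q
    simp only [Finset.mem_image, Finset.mem_filter, Finset.mem_Icc]
    constructor
    · rintro ⟨k, ⟨⟨hk2, hkn⟩, hl, hr⟩, rfl⟩
      rcases hcases k (by omega) (by omega) with ⟨i, hi, rfl⟩ | ⟨i, hi, rfl⟩ | ⟨i, hi, hin, rfl⟩
      · exfalso
        have h1 : 2 * i + 1 - 1 = 2 * (i - 1) + 2 := by omega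
        rw [h1, hweven (i - 1) (by omega), hwodd i hi] at hl
        have := hright (i - 1) (by omega)
        rw [Nat.sub_add_cancel (by omega)] at this
        exact hl.asymm this
      · rw [hweven i hi]; exact hpmem i hi
      · exfalso
        have h1 : i + 1 + d + 1 = (i + 1) + 1 + d := by omega
        rw [h1, hwtail i hi, hwtail (i + 1) (by omega)] at hr
        exact hr.asymm (hv i (i + 1) (by omega) (by omega))
    · intro hq
      rw [← hpP] at hq
      obtain ⟨i, hi, rfl⟩ := Finset.mem_image.1 hq
      rw [Finset.mem_range] at hi
      refine ⟨2 * i + 2, ⟨by omega, ?_, ?_⟩, hweven i hi⟩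
      · have h1 : 2 * i + 2 - 1 = 2 * i + 1 := by omega
        rw [h1, hwodd i hi.le, hweven i hi]
        exact hleft i hi
      · have h1 : 2 * i + 2 + 1 = 2 * (i + 1) + 1 := by omega
        rw [h1, hwodd (i + 1) hi, hweven i hi]
        exact hright i hi

theorem IsBallot.empty (M r h : ℕ) : IsBallot M r h ∅ := by
  simp [IsBallot]

theorem isBallot_succ_iff {M r h : ℕ} {P : Finset (ℕ × ℕ)} (hP : ∀ p ∈ P, p.2 ≤ r) :
    IsBallot M (r + 1) h P ↔ IsBallot M r (h + 1) P := by
  have hnot : r + 1 ∉ P.image Prod.snd := by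
    intro hmem
    obtain ⟨p, hp, hpr⟩ := Finset.mem_image.1 hmem
    have := hP p hp
    omega
  have hcard : ∀ p ∈ P,
      ((Finset.Icc 1 (r + 1)).filter fun y => p.2 < y ∧ y ∉ P.image Prod.snd).card =
        ((Finset.Icc 1 r).filter fun y => p.2 < y ∧ y ∉ P.image Prod.snd).card + 1 := by
    intro p hp
    have := hP p hp
    rw [← Finset.insert_Icc_right_eq_Icc_add_one (by omega), Finset.filter_insert,
      if_pos ⟨by omega, hnot⟩, Finset.card_insert_of_notMem (by simp)]
  unfold IsBallot
  refine and_congr ?_ (and_congr Iff.rfl ?_)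
  · refine forall₂_congr fun p hp => ?_
    have := hP p hp
    omega
  · refine forall₂_congr fun p hp => ?_
    rw [hcard p hp]
    constructor <;> intro h1 h2 <;> have := h1 h2 <;> omega

theorem isBallot_insert_iff {M r h c : ℕ} {Q : Finset (ℕ × ℕ)} (hQ : ∀ q ∈ Q, q.2 ≤ r) :
    IsBallot M (r + 1) h (insert (c, r + 1) Q) ↔
      (c < M ∧ IsBallot M r h Q) ∨ (c = M ∧ 2 ≤ h ∧ IsBallot M r (h - 1) Q) := by
  have hnot : (c, r + 1) ∉ Q := fun hmem => by simpa using hQ _ hmem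
  have hnotim : r + 1 ∉ Q.image Prod.snd := by
    intro hmem
    obtain ⟨p, hp, hpr⟩ := Finset.mem_image.1 hmem
    have := hQ p hp
    omega
  have hfree : ∀ x, (((Finset.Icc 1 (r + 1)).filter
      fun y => x < y ∧ y ∉ (insert (c, r + 1) Q).image Prod.snd)) =
        ((Finset.Icc 1 r).filter fun y => x < y ∧ y ∉ Q.image Prod.snd) := by
    intro x
    ext y
    simp only [Finset.image_insert, Finset.mem_filter, Finset.mem_Icc, Finset.mem_insert]
    constructor
    · rintro ⟨h1, h2, h3⟩
      push Not at h3
      exact ⟨by omega, h2, h3.2⟩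
    · rintro ⟨h1, h2, h3⟩
      refine ⟨by omega, h2, ?_⟩
      rintro (h4 | h4)
      · omega
      · exact h3 h4
  have hinj : Set.InjOn Prod.snd ((insert (c, r + 1) Q : Finset (ℕ × ℕ)) : Set (ℕ × ℕ)) ↔
      Set.InjOn Prod.snd (Q : Set (ℕ × ℕ)) := by
    rw [Finset.coe_insert, Set.injOn_insert (by simpa using hnot)]
    refine and_iff_left ?_
    rw [← Finset.coe_image]
    exact_mod_cast hnotim
  have hcardQ : ∀ q ∈ Q, ((insert (c, r + 1) Q).filter fun p => p.1 = M ∧ q.2 ≤ p.2).card =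
      (Q.filter fun p => p.1 = M ∧ q.2 ≤ p.2).card + if c = M then 1 else 0 := by
    intro q hq
    have := hQ q hq
    rw [Finset.filter_insert]
    split_ifs with h1 h2 h2
    · rw [Finset.card_insert_of_notMem (by simp [hnot])]
    · exact absurd h1.1 h2
    · exact absurd ⟨h2, by simp only; omega⟩ h1
    · rfl
  have htop : c = M →
      ((insert (c, r + 1) Q).filter fun p => p.1 = M ∧ r + 1 ≤ p.2).card = 1 := by
    intro hc
    rw [Finset.card_eq_one]
    refine ⟨(c, r + 1), ?_⟩
    ext p
    simp only [Finset.mem_filter, Finset.mem_insert, Finset.mem_singleton]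
    constructor
    · rintro ⟨h1 | h1, h2, h3⟩
      · exact h1
      · have := hQ p h1; omega
    · rintro rfl
      exact ⟨Or.inl rfl, hc, le_rfl⟩
  have htopfree : ((Finset.Icc 1 r).filter fun y => r + 1 < y ∧ y ∉ Q.image Prod.snd).card = 0 := by
    rw [Finset.card_eq_zero, Finset.filter_eq_empty_iff]
    intro y hy
    rw [Finset.mem_Icc] at hy
    omega
  unfold IsBallot
  rw [hinj]
  simp only [hfree, Finset.forall_mem_insert]
  constructor
  · rintro ⟨⟨⟨hc, -⟩, h1⟩, h2, h3, h4⟩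
    have h1' : ∀ p ∈ Q, p.1 ≤ M ∧ 1 ≤ p.2 ∧ p.2 ≤ r := fun p hp =>
      ⟨(h1 p hp).1, (h1 p hp).2.1, hQ p hp⟩
    rcases hc.lt_or_eq with hlt | heq
    · refine Or.inl ⟨hlt, h1', h2, fun p hp hpM => ?_⟩
      have := h4 p hp hpM
      rwa [hcardQ p hp, if_neg (by simpa using hlt.ne), add_zero] at this
    · have h3' := h3 heq
      rw [htop heq, htopfree] at h3'
      refine Or.inr ⟨heq, by omega, h1', h2, fun p hp hpM => ?_⟩
      have := h4 p hp hpM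
      rw [hcardQ p hp, if_pos heq] at this
      omega
  · have hup : (∀ p ∈ Q, p.1 ≤ M ∧ 1 ≤ p.2 ∧ p.2 ≤ r) →
        ∀ p ∈ Q, p.1 ≤ M ∧ 1 ≤ p.2 ∧ p.2 ≤ r + 1 := fun h p hp =>
      ⟨(h p hp).1, (h p hp).2.1, (h p hp).2.2.trans (Nat.le_succ r)⟩
    rintro (⟨hc, h1, h2, h3⟩ | ⟨hc, hh, h1, h2, h3⟩)
    · refine ⟨⟨⟨hc.le, by omega, le_rfl⟩, hup h1⟩, h2, fun h => absurd h hc.ne, fun p hp hpM => ?_⟩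
      rw [hcardQ p hp, if_neg hc.ne]
      exact h3 p hp hpM
    · refine ⟨⟨⟨hc.le, by omega, le_rfl⟩, hup h1⟩, h2, fun h => ?_, fun p hp hpM => ?_⟩
      · rw [htop h, htopfree]; omega
      · rw [hcardQ p hp, if_pos hc]
        have := h3 p hp hpM
        omega

open scoped Classical in
/-- The ballot sets with at most `d` elements. -/
noncomputable def ballotSets (M r h d : ℕ) : Finset (Finset (ℕ × ℕ)) :=
  (Finset.range (M + 1) ×ˢ Finset.Icc 1 r).powerset.filter fun P => IsBallot M r h P ∧ P.card ≤ d

theorem mem_ballotSets {M r h d : ℕ} {P : Finset (ℕ × ℕ)} :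
    P ∈ ballotSets M r h d ↔ IsBallot M r h P ∧ P.card ≤ d := by
  simp only [ballotSets, Finset.mem_filter, and_iff_right_iff_imp]
  rintro ⟨h, -⟩
  rw [Finset.mem_powerset]
  intro p hp
  have := h.1 p hp
  rw [Finset.mem_product, Finset.mem_range, Finset.mem_Icc]
  omega

theorem ballotSets_card_zero_right (M r h : ℕ) : (ballotSets M r h 0).card = 1 := by
  rw [Finset.card_eq_one]
  refine ⟨∅, ?_⟩
  ext P
  rw [mem_ballotSets, Finset.mem_singleton, Nat.le_zero, Finset.card_eq_zero]
  exact ⟨And.right, fun h => ⟨h ▸ IsBallot.empty M r _, h⟩⟩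

theorem ballotSets_card_zero_left (M h d : ℕ) : (ballotSets M 0 h d).card = 1 := by
  rw [Finset.card_eq_one]
  refine ⟨∅, ?_⟩
  ext P
  rw [mem_ballotSets, Finset.mem_singleton]
  constructor
  · rintro ⟨hP, -⟩
    rw [Finset.eq_empty_iff_forall_notMem]
    intro p hp
    have := hP.1 p hp
    omega
  · rintro rfl
    exact ⟨IsBallot.empty M 0 h, by simp⟩

theorem ballotSets_card_succ (M r h d : ℕ) :
    (ballotSets M (r + 1) h (d + 1)).card =
      (ballotSets M r (h + 1) (d + 1)).card + M * (ballotSets M r h d).card +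
        if 2 ≤ h then (ballotSets M r (h - 1) d).card else 0 := by
  classical
  set g : ℕ → Finset (Finset (ℕ × ℕ)) := fun c =>
    if c < M then ballotSets M r h d else if 2 ≤ h then ballotSets M r (h - 1) d else ∅ with hg
  have hgle : ∀ c, ∀ Q ∈ g c, ∀ q ∈ Q, q.2 ≤ r := by
    intro c Q hQ q hq
    simp only [hg] at hQ
    split_ifs at hQ
    · exact ((mem_ballotSets.1 hQ).1.1 q hq).2.2
    · exact ((mem_ballotSets.1 hQ).1.1 q hq).2.2
    · simp at hQ
  have hgnot : ∀ c c', ∀ Q ∈ g c, (c', r + 1) ∉ Q := fun c c' Q hQ hmem => by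
    simpa using hgle c Q hQ _ hmem
  have hunion : ballotSets M (r + 1) h (d + 1) = ballotSets M r (h + 1) (d + 1) ∪
      (Finset.range (M + 1)).biUnion fun c => (g c).image (insert (c, r + 1)) := by
    ext P
    simp only [Finset.mem_union, Finset.mem_biUnion, Finset.mem_image, Finset.mem_range]
    constructor
    · intro hP
      obtain ⟨hB, hcard⟩ := mem_ballotSets.1 hP
      by_cases hr : r + 1 ∈ P.image Prod.snd
      · right
        obtain ⟨⟨c, x⟩, hp, hx⟩ := Finset.mem_image.1 hr
        simp only at hx
        subst hx
        have hQ : ∀ q ∈ P.erase (c, r + 1), q.2 ≤ r := by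
          intro q hq
          obtain ⟨hne, hqP⟩ := Finset.mem_erase.1 hq
          have h1 := (hB.1 q hqP).2.2
          by_contra hlt
          exact hne (hB.2.1 hqP hp (by simp only; omega))
        have hc := (hB.1 _ hp).1
        have hcard' : (P.erase (c, r + 1)).card ≤ d := by
          rw [Finset.card_erase_of_mem hp]; omega
        refine ⟨c, Nat.lt_succ_of_le hc, P.erase (c, r + 1), ?_, Finset.insert_erase hp⟩
        rw [← Finset.insert_erase hp, isBallot_insert_iff hQ] at hB
        rcases hB with ⟨h1, h2⟩ | ⟨h1, h2, h3⟩
        · simp only [hg, if_pos h1]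
          exact mem_ballotSets.2 ⟨h2, hcard'⟩
        · simp only [hg, if_neg (show ¬ c < M by omega), if_pos h2]
          exact mem_ballotSets.2 ⟨h3, hcard'⟩
      · left
        refine mem_ballotSets.2 ⟨(isBallot_succ_iff fun p hp => ?_).1 hB, hcard⟩
        have h1 := (hB.1 p hp).2.2
        have h2 : p.2 ≠ r + 1 := fun h => hr (h ▸ Finset.mem_image_of_mem _ hp)
        omega
    · rintro (hP | ⟨c, hc, Q, hQ, rfl⟩)
      · obtain ⟨hB, hcard⟩ := mem_ballotSets.1 hP
        exact mem_ballotSets.2 ⟨(isBallot_succ_iff fun p hp => (hB.1 p hp).2.2).2 hB, hcard⟩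
      · have hle := hgle c Q hQ
        rw [mem_ballotSets, isBallot_insert_iff hle,
          Finset.card_insert_of_notMem (hgnot c c Q hQ)]
        simp only [hg] at hQ
        split_ifs at hQ with h1 h2
        · obtain ⟨hB, hcard⟩ := mem_ballotSets.1 hQ
          exact ⟨Or.inl ⟨h1, hB⟩, by omega⟩
        · obtain ⟨hB, hcard⟩ := mem_ballotSets.1 hQ
          exact ⟨Or.inr ⟨by omega, h2, hB⟩, by omega⟩
        · simp at hQ
  have hdisj : Disjoint (ballotSets M r (h + 1) (d + 1))
      ((Finset.range (M + 1)).biUnion fun c => (g c).image (insert (c, r + 1))) := by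
    rw [Finset.disjoint_left]
    intro P hP hP'
    simp only [Finset.mem_biUnion, Finset.mem_image] at hP'
    obtain ⟨c, -, Q, -, rfl⟩ := hP'
    have := ((mem_ballotSets.1 hP).1.1 (c, r + 1) (Finset.mem_insert_self _ _)).2.2
    simp at this
  have hcardg : ∀ c, ((g c).image (insert (c, r + 1))).card = (g c).card := by
    intro c
    refine Finset.card_image_of_injOn fun Q hQ Q' hQ' heq => ?_
    rw [← Finset.erase_insert (hgnot c c Q hQ), heq, Finset.erase_insert (hgnot c c Q' hQ')]
  rw [hunion, Finset.card_union_of_disjoint hdisj, Finset.card_biUnion]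
  · simp only [hcardg]
    rw [Finset.sum_range_succ, add_assoc]
    congr 2
    · rw [Finset.sum_congr rfl (g := fun _ => (ballotSets M r h d).card), Finset.sum_const,
        Finset.card_range, smul_eq_mul]
      intro c hc
      simp only [hg, if_pos (Finset.mem_range.1 hc)]
    · simp only [hg, lt_irrefl, if_false]
      split_ifs <;> simp
  · intro c _ c' _ hne
    rw [Function.onFun, Finset.disjoint_left]
    intro P hP hP'
    obtain ⟨Q, hQ, rfl⟩ := Finset.mem_image.1 hP
    obtain ⟨Q', hQ', heq⟩ := Finset.mem_image.1 hP'
    have hmem : (c, r + 1) ∈ insert (c', r + 1) Q' := heq ▸ Finset.mem_insert_self _ _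
    rcases Finset.mem_insert.1 hmem with h1 | h1
    · exact hne (Prod.ext_iff.1 h1).1
    · exact hgnot c' c Q' hQ' h1

/-- The number of partially colored subsets of `{1,…,n}` with `m` colors and fewer than `e`
elements. -/
def coloredSubsetCount (m n e : ℕ) : ℤ :=
  ∑ i ∈ Finset.range e, (Nat.choose n i : ℤ) * (m : ℤ) ^ i

theorem coloredSubsetCount_succ_succ (m n e : ℕ) :
    coloredSubsetCount m (n + 1) (e + 1) =
      coloredSubsetCount m n (e + 1) + m * coloredSubsetCount m n e := by
  unfold coloredSubsetCount
  rw [Finset.sum_range_succ', Finset.sum_range_succ' (n := e) (M := ℤ), Finset.mul_sum,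
    add_right_comm, ← Finset.sum_add_distrib]
  simp only [Nat.choose_zero_right]
  congr 1
  refine Finset.sum_congr rfl fun i _ => ?_
  rw [Nat.choose_succ_succ]
  push_cast
  ring

theorem coloredSubsetCount_zero_left_succ (m e : ℕ) : coloredSubsetCount m 0 (e + 1) = 1 := by
  unfold coloredSubsetCount
  rw [Finset.sum_range_succ']
  simp

theorem coloredSubsetCount_zero_right (m n : ℕ) : coloredSubsetCount m n 0 = 0 := by
  simp [coloredSubsetCount]

theorem ballotSets_card_of_pos (M r h d : ℕ) (hh : 1 ≤ h) (hd : 2 * d + 1 ≤ r + h) :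
    ((ballotSets M r h d).card : ℤ) =
      coloredSubsetCount (M + 1) r (d + 1) - coloredSubsetCount (M + 1) r (d + 1 - h) := by
  induction r generalizing h d with
  | zero =>
    rw [ballotSets_card_zero_left, coloredSubsetCount_zero_left_succ,
      show d + 1 - h = 0 by omega, coloredSubsetCount_zero_right]
    simp
  | succ r ih =>
    cases d with
    | zero =>
      rw [ballotSets_card_zero_right, show 0 + 1 - h = 0 by omega]
      simp [coloredSubsetCount]
    | succ d =>
      rw [ballotSets_card_succ]
      push_cast
      rw [ih (h + 1) (d + 1) (by omega) (by omega), ih h d hh (by omega),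
        coloredSubsetCount_succ_succ]
      obtain ⟨k, rfl⟩ : ∃ k, h = k + 1 := ⟨h - 1, by omega⟩
      cases k with
      | zero =>
        rw [if_neg (by omega), show d + 1 + 1 - (0 + 1 + 1) = d by omega,
          show d + 1 - (0 + 1) = d by omega, show d + 1 + 1 - (0 + 1) = d + 1 by omega,
          coloredSubsetCount_succ_succ]
        push_cast
        ring
      | succ k =>
        rw [if_pos (by omega), ih (k + 1 + 1 - 1) d (by omega) (by omega),
          show d + 1 + 1 - (k + 1 + 1 + 1) = d - k - 1 by omega,
          show d + 1 - (k + 1 + 1) = d - k - 1 by omega,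
          show d + 1 - (k + 1 + 1 - 1) = d - k by omega,
          show d + 1 + 1 - (k + 1 + 1) = d - k by omega]
        cases d - k with
        | zero =>
          simp only [coloredSubsetCount_zero_right, Nat.zero_sub]
          push_cast
          ring
        | succ e =>
          rw [Nat.add_sub_cancel, coloredSubsetCount_succ_succ]
          push_cast
          ring

/-- The alternating sum of the numbers of partially colored subsets. -/
def alternatingCount (m n d : ℕ) : ℤ :=
  ∑ i ∈ Finset.range (d + 1), (Nat.choose n i : ℤ) * (m : ℤ) ^ i * (-1) ^ (i + d)

theorem alternatingCount_succ_right (m n d : ℕ) :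
    alternatingCount m n (d + 1) =
      (Nat.choose n (d + 1) : ℤ) * (m : ℤ) ^ (d + 1) - alternatingCount m n d := by
  unfold alternatingCount
  rw [Finset.sum_range_succ, Even.neg_one_pow ⟨d + 1, rfl⟩, mul_one, add_comm, sub_eq_add_neg,
    ← Finset.sum_neg_distrib]
  congr 1
  refine Finset.sum_congr rfl fun i _ => ?_
  rw [← add_assoc, pow_succ]
  ring

theorem alternatingCount_succ_succ (m n d : ℕ) :
    alternatingCount m (n + 1) (d + 1) =
      alternatingCount m n (d + 1) + m * alternatingCount m n d := by
  unfold alternatingCount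
  rw [Finset.sum_range_succ', Finset.sum_range_succ' (n := d + 1), Finset.mul_sum,
    add_right_comm, ← Finset.sum_add_distrib]
  simp only [Nat.choose_zero_right]
  congr 1
  refine Finset.sum_congr rfl fun i _ => ?_
  rw [Nat.choose_succ_succ, show i + 1 + (d + 1) = i + d + 2 by ring, pow_add (-1 : ℤ) (i + d) 2]
  push_cast
  ring

theorem ballotSets_card_zero_height (M r d : ℕ) (hd : 2 * d + 1 ≤ r) :
    ((ballotSets M r 0 d).card : ℤ) = alternatingCount (M + 1) r d := by
  induction r generalizing d with
  | zero => omega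
  | succ r ih =>
    cases d with
    | zero => simp [ballotSets_card_zero_right, alternatingCount]
    | succ d =>
      rw [ballotSets_card_succ, if_neg (by omega), alternatingCount_succ_succ,
        alternatingCount_succ_right]
      push_cast
      rw [ih d (by omega), ballotSets_card_of_pos M r (0 + 1) (d + 1) (by omega) (by omega)]
      unfold coloredSubsetCount
      rw [Finset.sum_range_succ, show d + 1 + 1 - (0 + 1) = d + 1 by omega]
      push_cast
      ring

/-- `#APS_d(m,n) = Σ_{i=0}^{d} C(n,i) mⁱ (-1)^{i+d}` as integers. -/
theorem APS_card_alternating (m n d : ℕ) (hm : 1 ≤ m) (hn : 1 ≤ n)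
    (hd : d ≤ (n - 1) / 2) :
    ((APS m n d).ncard : ℤ) =
      ∑ i ∈ Finset.range (d + 1), (Nat.choose n i : ℤ) * (m : ℤ) ^ i * (-1) ^ (i + d) := by
  obtain ⟨M, rfl⟩ : ∃ M, m = M + 1 := ⟨m - 1, by omega⟩
  have hAPS : APS (M + 1) n d = (ballotSets M n 0 d : Set (Finset (ℕ × ℕ))) := by
    ext P
    rw [Finset.mem_coe, mem_ballotSets]
    exact and_congr_left fun hcard =>
      ⟨isBallot_of_isAdmissible, fun hP => isAdmissible_of_isBallot hP (by omega)⟩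
  rw [hAPS, Set.ncard_coe_finset]
  exact ballotSets_card_zero_height M n d (by omega)
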